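/- arXiv:1602.04031 — 9 statements merged into one kernel-verified Lean document; each statement's English description precedes it below -/
import Mathlib

section
/- For every natural number n ≥ 0, (4/(n+1)) · Σ_{0 ≤ k < ℓ < ⌈n/2⌉} C(n,k)/C(n,ℓ) + [n even] · (1/(n+1)) · (2^n/C(n, n/2) − 1) + 1 = H^odd_{n+1}. (This identity expresses that the double-sum formula for the expected number of zeros of a random lattice path of length n, obtained by generating functions, equals the odd harmonic number obtained by the probabilistic approach.) -/
/-- The odd harmonic number `H^odd_n = ∑_{m=1}^n [m odd]/m`. -/
def Hodd (n : ℕ) : ℚ := ∑ m ∈ Finset.Icc 1 n, if Odd m then (1 : ℚ) / m else 0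

def auxA (n l : ℕ) : ℚ := ∑ k ∈ Finset.range l, (n.choose k : ℚ) / (n.choose l : ℚ)

lemma auxA_eq (n l : ℕ) : auxA n l = (∑ k ∈ Finset.range l, (n.choose k : ℚ)) / (n.choose l : ℚ) := by
  rw [auxA, Finset.sum_div]

lemma aux_choose_succ (n l : ℕ) (h : l ≤ n) :
    (n.choose (l+1) : ℚ) * (l+1) = n.choose l * ((n:ℚ) - l) := by
  have := Nat.choose_succ_right_eq n l
  rw [← Nat.cast_sub h]
  exact_mod_cast this

lemma aux_choose_n (n l : ℕ) (h : l ≤ n) :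
    ((n+1).choose l : ℚ) * ((n:ℚ) + 1 - l) = n.choose l * ((n:ℚ) + 1) := by
  have := Nat.choose_mul_succ_eq n l
  have h2 : ((n:ℚ) + 1 - l) = ((n + 1 - l : ℕ) : ℚ) := by
    rw [Nat.cast_sub (by omega)]; push_cast; ring
  rw [h2]
  exact_mod_cast this.symm

lemma auxA_zero (n : ℕ) : auxA n 0 = 0 := by simp [auxA]

lemma auxA_l (n l : ℕ) (h : l < n) :
    ((n:ℚ) - l) * auxA n (l+1) = (l+1) * (auxA n l + 1) := by
  have h0 : (n.choose l : ℚ) ≠ 0 := by exact_mod_cast (Nat.choose_pos h.le).ne'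
  have h1 : (n.choose (l+1) : ℚ) ≠ 0 := by exact_mod_cast (Nat.choose_pos h).ne'
  have h2 := aux_choose_succ n l h.le
  rw [auxA_eq, auxA_eq, Finset.sum_range_succ]
  field_simp
  linear_combination -h2

lemma aux_S (n l : ℕ) : (∑ k ∈ Finset.range (l+1), ((n+1).choose k : ℚ)) =
    2 * (∑ k ∈ Finset.range (l+1), (n.choose k : ℚ)) - n.choose l := by
  induction l with
  | zero => simp; norm_num
  | succ l ih =>
    rw [Finset.sum_range_succ, ih, Finset.sum_range_succ _ (l+1), Nat.choose_succ_succ]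
    push_cast; ring

lemma auxA_n (n l : ℕ) (h : l ≤ n) :
    ((n:ℚ) + 1) * auxA (n+1) l = 2 * ((n:ℚ) + 1 - l) * auxA n l - l := by
  rcases l with _ | l
  · simp [auxA_zero]
  have h0 : (n.choose (l+1) : ℚ) ≠ 0 := by exact_mod_cast (Nat.choose_pos h).ne'
  have h1 : ((n+1).choose (l+1) : ℚ) ≠ 0 := by
    exact_mod_cast (Nat.choose_pos (by omega : l + 1 ≤ n+1)).ne'
  have h2 := aux_choose_n n (l+1) h
  have h3 := aux_choose_succ n l (by omega)
  rw [auxA_eq, auxA_eq, aux_S]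
  generalize (∑ k ∈ Finset.range (l+1), (n.choose k : ℚ)) = S at *
  push_cast at *
  field_simp
  linear_combination (-(2*S - n.choose l)) * h2 + ((n+1).choose (l+1) : ℚ) * h3

def auxT (n L : ℕ) : ℚ := ∑ l ∈ Finset.range L, auxA n l

lemma auxT_succ (n L : ℕ) : auxT n (L+1) = auxT n L + auxA n L := by
  rw [auxT, Finset.sum_range_succ, ← auxT]

lemma auxT_step (n L : ℕ) (h : L ≤ n) :
    ((n:ℚ)+1) * auxT (n+1) L - ((n:ℚ)+2) * auxT n L = L - ((n:ℚ) + 1 - L) * auxA n L := by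
  induction L with
  | zero => simp [auxT, auxA_zero]
  | succ L ih =>
    have h1 := ih (by omega)
    have h2 := auxA_n n L (by omega)
    have h3 := auxA_l n L h
    rw [auxT_succ, auxT_succ]
    push_cast
    linear_combination h1 + h2 + h3

lemma auxA_mid_odd (m : ℕ) : (2*(m:ℚ)+1) * auxA (2*m+1) m = 2*(m+1) * auxA (2*m) m - m := by
  have := auxA_n (2*m) m (by omega)
  push_cast at this
  linear_combination this

lemma auxA_mid_odd' (m : ℕ) : auxA (2*m+1) (m+1) = auxA (2*m+1) m + 1 := by
  have := auxA_l (2*m+1) m (by omega)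
  push_cast at this
  have h : (m:ℚ) + 1 ≠ 0 := by positivity
  apply mul_left_cancel₀ h
  linear_combination this

lemma auxA_mid_even (m : ℕ) : auxA (2*m+2) (m+1) = auxA (2*m+1) m + 1/2 := by
  have := auxA_n (2*m+1) (m+1) (by omega)
  rw [auxA_mid_odd'] at this
  push_cast at this
  have h : 2*((m:ℚ) + 1) ≠ 0 := by positivity
  apply mul_left_cancel₀ h
  linear_combination this

lemma auxX (m : ℕ) : (2:ℚ)^(2*m) / ((2*m).choose m : ℚ) = 2 * auxA (2*m) m + 1 := by
  induction m with
  | zero => simp [auxA_zero]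
  | succ m ih =>
    have h1 := auxA_mid_even m
    have h2 := auxA_mid_odd m
    have h3 := Nat.succ_mul_centralBinom_succ m
    simp only [Nat.centralBinom] at h3
    have h3' : ((m:ℚ)+1) * ((2*(m+1)).choose (m+1) : ℚ) = 2*(2*m+1) * ((2*m).choose m : ℚ) := by
      exact_mod_cast h3
    have p1 : ((2*m).choose m : ℚ) ≠ 0 := by
      exact_mod_cast (Nat.choose_pos (by omega : m ≤ 2*m)).ne'
    have p2 : ((2*(m+1)).choose (m+1) : ℚ) ≠ 0 := by
      exact_mod_cast (Nat.choose_pos (by omega : m+1 ≤ 2*(m+1))).ne'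
    rw [show auxA (2*(m+1)) (m+1) = auxA (2*m+2) (m+1) from rfl, h1]
    have h : 2*(m:ℚ) + 1 ≠ 0 := by positivity
    rw [div_eq_iff p1] at ih
    rw [div_eq_iff p2, show 2*(m+1) = 2*m+2 from rfl, pow_add, ih]
    rw [show 2*(m+1) = 2*m+2 from rfl] at h3'
    apply mul_left_cancel₀ h
    have hm : (m:ℚ) + 1 ≠ 0 := by positivity
    apply mul_left_cancel₀ hm
    generalize ((2*m+2).choose (m+1) : ℚ) = C' at *
    generalize ((2*m).choose m : ℚ) = C at *
    linear_combination (-2 * ((m:ℚ)+1) * C') * h2 - 2 * ((m:ℚ)+1) * (2 * auxA (2*m) m + 1) * h3'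

lemma Hodd_succ (n : ℕ) : Hodd (n+1) = Hodd n + if Odd (n+1) then (1 : ℚ) / ((n+1 : ℕ) : ℚ) else 0 := by
  rw [Hodd, Finset.sum_Icc_succ_top (by omega), ← Hodd]

lemma Hodd_even (m : ℕ) : Hodd (2*m+2) = Hodd (2*m+1) := by
  rw [Hodd_succ, if_neg (by rw [Nat.not_odd_iff_even]; exact ⟨m+1, by ring⟩), add_zero]

lemma Hodd_odd (m : ℕ) : Hodd (2*m+3) = Hodd (2*m+2) + 1/(2*m+3) := by
  rw [Hodd_succ, if_pos ⟨m+1, by ring⟩]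
  push_cast; ring

lemma aux_odd (m : ℕ)
    (h : 4 * auxT (2*m) m + 2 * auxA (2*m) m + (2*m+1) = (2*m+1) * Hodd (2*m+1)) :
    4 * auxT (2*m+1) (m+1) + (2*m+2) = (2*m+2) * Hodd (2*m+2) := by
  have h1 := auxT_step (2*m) m (by omega)
  have h2 := auxA_mid_odd m
  rw [Hodd_even, auxT_succ]
  push_cast at h1
  have hm : 2*(m:ℚ) + 1 ≠ 0 := by positivity
  apply mul_left_cancel₀ hm
  linear_combination 4 * h1 + 4 * h2 + (2*(m:ℚ)+2) * h

lemma aux_even (m : ℕ) :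
    4 * auxT (2*m) m + 2 * auxA (2*m) m + (2*m+1) = (2*m+1) * Hodd (2*m+1) := by
  induction m with
  | zero => simp [auxT, auxA_zero, Hodd]
  | succ m ih =>
    have h := aux_odd m ih
    have h1 := auxT_step (2*m+1) (m+1) (by omega)
    have h2 := auxA_mid_even m
    have h4 := Hodd_odd m
    rw [auxA_mid_odd'] at h1
    rw [show 2*(m+1) = 2*m+2 from rfl, h2, h4]
    push_cast at h1 ⊢
    have hm : 2*(m:ℚ) + 2 ≠ 0 := by positivity
    have hm3 : 2*(m:ℚ) + 3 ≠ 0 := by positivity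
    have h5 : (2*(m:ℚ)+3) * (1/(2*m+3)) = 1 := by field_simp
    apply mul_left_cancel₀ hm
    linear_combination 4 * h1 + (2*(m:ℚ)+3) * h - (2*(m:ℚ)+2) * h5

/-- For every `n ≥ 0`,
`(4/(n+1)) · Σ_{0 ≤ k < ℓ < ⌈n/2⌉} C(n,k)/C(n,ℓ)
  + [n even]·(1/(n+1))·(2^n/C(n,n/2) − 1) + 1 = H^odd_{n+1}`. -/
theorem double_sum_formula_eq_odd_harmonic (n : ℕ) :
    (4 / ((n : ℚ) + 1)) *
        (∑ l ∈ Finset.range ((n + 1) / 2), ∑ k ∈ Finset.range l,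
          (n.choose k : ℚ) / (n.choose l : ℚ))
      + (if Even n then
          (1 / ((n : ℚ) + 1)) * ((2 : ℚ) ^ n / (n.choose (n / 2) : ℚ) - 1) else 0)
      + 1 = Hodd (n + 1) := by
  change (4 / ((n : ℚ) + 1)) * auxT n ((n+1)/2) + _ + 1 = _
  have hn : (n:ℚ) + 1 ≠ 0 := by positivity
  rcases Nat.even_or_odd' n with ⟨m, rfl | rfl⟩
  · rw [if_pos (even_two_mul m), show (2*m+1)/2 = m by omega, show 2*m/2 = m by omega, auxX]
    have h := aux_even m
    push_cast at hn ⊢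
    field_simp
    linear_combination h
  · rw [if_neg (by rw [Nat.not_even_iff_odd]; exact ⟨m, rfl⟩), show (2*m+1+1)/2 = m+1 by omega]
    have h := aux_odd m (aux_even m)
    rw [show 2*m+1+1 = 2*m+2 from rfl]
    push_cast at hn ⊢
    field_simp
    linear_combination h
end

section
/- For every natural number n ≥ 0, (2/(⌊n/2⌋+1)) · Σ_{0 ≤ k < ℓ ≤ ⌊n/2⌋} C(2⌊n/2⌋+1, k)/C(2⌊n/2⌋+1, ℓ) + 1 = H^odd_{n+1}. -/
def aR (N l : ℕ) : ℚ := ∑ k ∈ Finset.range l, (N.choose k : ℚ) / (N.choose l : ℚ)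

lemma aR_zero (N : ℕ) : aR N 0 = 0 := by simp [aR]

lemma aR_rec (N l : ℕ) (h : l < N) :
    ((N : ℚ) - l) * aR N (l + 1) = (l + 1) * (aR N l + 1) := by
  have h1 : (N.choose l : ℚ) ≠ 0 := by exact_mod_cast (Nat.choose_pos h.le).ne'
  have h2 : (N.choose (l + 1) : ℚ) ≠ 0 := by exact_mod_cast (Nat.choose_pos h).ne'
  have h3 : (N.choose (l + 1) : ℚ) * (l + 1) = N.choose l * ((N : ℚ) - l) := by
    have := Nat.choose_succ_right_eq N l
    rw [← Nat.cast_sub h.le]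
    exact_mod_cast this
  unfold aR
  rw [← Finset.sum_div, ← Finset.sum_div, Finset.sum_range_succ]
  field_simp
  linear_combination -h3

lemma aR_up (N l : ℕ) (h : l ≤ N) :
    ((N : ℚ) + 1) * aR (N + 1) l = 2 * aR N l * ((N : ℚ) + 1 - l) - l := by
  induction l with
  | zero => simp [aR_zero]
  | succ l ih =>
    have ih := ih (by omega)
    have r1 := aR_rec N l (by omega)
    have r2 := aR_rec (N + 1) l (by omega)
    have hl : (l : ℚ) + 1 ≤ N := by exact_mod_cast h
    have hne : (N : ℚ) + 1 - l ≠ 0 := by linarith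
    push_cast at *
    apply mul_left_cancel₀ hne
    linear_combination ((N : ℚ) + 1) * r2 + (l + 1) * ih - 2 * ((N : ℚ) + 1 - l) * r1

lemma T_up (N M : ℕ) (h : M ≤ N) :
    ((N : ℚ) + 1) * ∑ l ∈ Finset.range (M + 1), aR (N + 1) l
      = (N + 2) * ∑ l ∈ Finset.range (M + 1), aR N l - (M + 1) * aR N M := by
  induction M with
  | zero => simp [aR_zero]
  | succ M ih =>
    have ih := ih (by omega)
    have r1 := aR_rec N M (by omega)
    have r2 := aR_up N (M + 1) h
    rw [Finset.sum_range_succ _ (M + 1), Finset.sum_range_succ _ (M + 1)]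
    push_cast at *
    linear_combination ih + r2 + r1

lemma T_step (m : ℕ) :
    ∑ l ∈ Finset.range (m + 2), aR (2 * m + 3) l
      = (m + 2) / (m + 1) * ∑ l ∈ Finset.range (m + 1), aR (2 * m + 1) l
        + (m + 2) / (2 * (2 * m + 3)) := by
  have t1 := T_up (2 * m + 1) m (by omega)
  have t2 := T_up (2 * m + 2) m (by omega)
  have u1 := aR_up (2 * m + 1) m (by omega)
  have u2 := aR_up (2 * m + 2) m (by omega)
  have r := aR_rec (2 * m + 3) m (by omega)
  rw [Finset.sum_range_succ _ (m + 1)]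
  norm_num [add_assoc] at t1 t2 u1 u2 r ⊢
  generalize ∑ l ∈ Finset.range (m + 1), aR (2 * m + 1) l = T at *
  generalize ∑ l ∈ Finset.range (m + 1), aR (2 * m + 2) l = T1 at *
  generalize ∑ l ∈ Finset.range (m + 1), aR (2 * m + 3) l = T2 at *
  generalize aR (2 * m + 1) m = x at *
  generalize aR (2 * m + 2) m = y at *
  generalize aR (2 * m + 3) m = z at *
  generalize aR (2 * m + 3) (m + 1) = w at *
  have hm : (0 : ℚ) ≤ m := by positivity
  generalize (m : ℚ) = q at *
  have h1 : q + 1 ≠ 0 := by linarith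
  have h2 : 2 * q + 3 ≠ 0 := by linarith
  have h3 : q + 3 ≠ 0 := by linarith
  have e1 : T1 = ((2 * q + 3) * T - (q + 1) * x) / (2 * (q + 1)) := by
    rw [eq_div_iff (by simpa using h1)]; linear_combination t1
  have e2 : y = (2 * x * (q + 2) - q) / (2 * (q + 1)) := by
    rw [eq_div_iff (by simpa using h1)]; linear_combination u1
  have e3 : T2 = ((2 * q + 4) * T1 - (q + 1) * y) / (2 * q + 3) := by
    rw [eq_div_iff h2]; linear_combination t2
  have e4 : z = (2 * y * (q + 3) - q) / (2 * q + 3) := by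
    rw [eq_div_iff h2]; linear_combination u2
  have e5 : w = (q + 1) * (z + 1) / (q + 3) := by
    rw [eq_div_iff h3]; linear_combination r
  rw [e5, e4, e3, e2, e1]
  field_simp
  ring

lemma Hodd_step (m : ℕ) : Hodd (2 * m + 3) = Hodd (2 * m + 1) + 1 / (2 * m + 3) := by
  unfold Hodd
  rw [Finset.sum_Icc_succ_top (by omega), Finset.sum_Icc_succ_top (by omega),
    if_neg (by simp [parity_simps]), if_pos ⟨m + 1, by ring⟩]
  push_cast
  ring

lemma Hodd_main (m : ℕ) :
    (2 / ((m : ℚ) + 1)) * (∑ l ∈ Finset.range (m + 1), aR (2 * m + 1) l) + 1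
      = Hodd (2 * m + 1) := by
  induction m with
  | zero => simp [aR_zero, Hodd]
  | succ m ih =>
    have e : 2 * (m + 1) + 1 = 2 * m + 3 := by ring
    rw [e, Hodd_step, ← ih, T_step]
    have h1 : (m : ℚ) + 1 ≠ 0 := by positivity
    have h2 : (m : ℚ) + 2 ≠ 0 := by positivity
    have h3 : 2 * (m : ℚ) + 3 ≠ 0 := by positivity
    have h4 : (m : ℚ) + 1 + 1 = m + 2 := by ring
    push_cast
    rw [h4]
    field_simp
    ring

/-- For every `n ≥ 0`,
`(2/(⌊n/2⌋+1)) · Σ_{0 ≤ k < ℓ ≤ ⌊n/2⌋} C(2⌊n/2⌋+1,k)/C(2⌊n/2⌋+1,ℓ) + 1 = H^odd_{n+1}`. -/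
theorem simplified_double_sum_eq_odd_harmonic (n : ℕ) :
    (2 / ((n / 2 : ℕ) + 1 : ℚ)) *
        (∑ l ∈ Finset.range (n / 2 + 1), ∑ k ∈ Finset.range l,
          ((2 * (n / 2) + 1).choose k : ℚ) / ((2 * (n / 2) + 1).choose l : ℚ))
      + 1 = Hodd (n + 1) := by
  have h : Hodd (n + 1) = Hodd (2 * (n / 2) + 1) := by
    rcases Nat.even_or_odd' n with ⟨c, rfl | rfl⟩
    · congr 1; omega
    · have : (2 * c + 1) / 2 = c := by omega
      rw [this]
      unfold Hodd
      rw [Finset.sum_Icc_succ_top (by omega), if_neg (by simp [parity_simps]), add_zero]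
  rw [h, ← Hodd_main]
  rfl
end

section
/- For every natural number n ≥ 0, (1/(n+1)) · Σ_{m=0}^{⌊n/2⌋} Σ_{ℓ=m}^{n−m} C(2m,m) · C(n−2m, ℓ−m) / C(n,ℓ) = H^odd_{n+1}. -/
def qbeta (a b : ℕ) : ℚ := (a.factorial : ℚ) * b.factorial / (a + b + 1).factorial

lemma qbeta_rec (a b : ℕ) : qbeta a (b+1) + qbeta (a+1) b = qbeta a b := by
  unfold qbeta
  have e1 : a + (b+1) + 1 = (a+b+1)+1 := by ring
  have e2 : (a+1) + b + 1 = (a+b+1)+1 := by ring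
  rw [e1, e2, Nat.factorial_succ (a+b+1), Nat.factorial_succ a, Nat.factorial_succ b]
  have h : ((a+b+1).factorial : ℚ) ≠ 0 := by positivity
  have h2 : ((a:ℚ)+b+1+1) ≠ 0 := by positivity
  push_cast
  field_simp
  ring

lemma qbeta_sum (N : ℕ) : ∀ a b : ℕ,
    ∑ k ∈ Finset.range (N+1), (N.choose k : ℚ) * qbeta (a+k) (b+(N-k)) = qbeta a b := by
  induction N with
  | zero => intro a b; simp
  | succ N ih =>
    intro a b
    rw [← qbeta_rec a b, ← ih a (b+1), ← ih (a+1) b, Finset.sum_range_succ']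
    have h1 : ∀ k ∈ Finset.range (N+1),
        ((N+1).choose (k+1) : ℚ) * qbeta (a+(k+1)) (b+(N+1-(k+1)))
        = (N.choose k : ℚ) * qbeta (a+1+k) (b+(N-k))
          + (N.choose (k+1) : ℚ) * qbeta (a+(k+1)) (b+1+(N-(k+1))) := by
      intro k hk
      have hk := Finset.mem_range.1 hk
      rw [Nat.choose_succ_succ, Nat.add_sub_add_right, show a+1+k = a+(k+1) by ring]
      push_cast
      rcases Nat.lt_or_ge k N with h | h
      · rw [show b+1+(N-(k+1)) = b+(N-k) by omega]; ring
      · rw [Nat.choose_eq_zero_of_lt (show N < k+1 by omega)]; push_cast; ring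
    rw [Finset.sum_congr rfl h1, Finset.sum_add_distrib, Finset.sum_range_succ (fun k => (N.choose (k+1) : ℚ) * qbeta (a+(k+1)) (b+1+(N-(k+1)))), Finset.sum_range_succ' (fun k => (N.choose k : ℚ) * qbeta (a+k) (b+1+(N-k)))]
    simp only [Nat.choose_succ_self, Nat.choose_zero_right, Nat.sub_zero]
    rw [show b + 1 + N = b + (N+1) by ring]
    push_cast
    ring

lemma qs_inner_sum (n m : ℕ) (h : 2 * m ≤ n) :
    (1 / ((n : ℚ) + 1)) * ∑ l ∈ Finset.Icc m (n - m),
          ((2 * m).choose m : ℚ) * ((n - 2 * m).choose (l - m) : ℚ) / (n.choose l : ℚ)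
      = 1 / (2 * m + 1 : ℕ) := by
  have hI : Finset.Icc m (n-m) = Finset.Ico m (n-m+1) := by ext; simp only [Finset.mem_Icc, Finset.mem_Ico]; omega
  rw [hI, Finset.sum_Ico_eq_sum_range, show n - m + 1 - m = (n-2*m)+1 by omega, Finset.mul_sum]
  have h1 : ∀ k ∈ Finset.range (n-2*m+1),
      (1 / ((n : ℚ) + 1)) * (((2 * m).choose m : ℚ) * ((n - 2 * m).choose (m + k - m) : ℚ) / (n.choose (m+k) : ℚ))
      = ((2 * m).choose m : ℚ) * (((n-2*m).choose k : ℚ) * qbeta (m+k) (m+(n-2*m-k))) := by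
    intro k hk
    have hk := Finset.mem_range.1 hk
    have e : m + (n-2*m-k) = n - (m+k) := by omega
    rw [e, Nat.add_sub_cancel_left, Nat.cast_choose ℚ (show m + k ≤ n by omega)]
    unfold qbeta
    rw [show m + k + (n - (m+k)) + 1 = n + 1 by omega, Nat.factorial_succ n]
    have := Nat.factorial_ne_zero n
    have := Nat.factorial_ne_zero (m+k)
    have := Nat.factorial_ne_zero (n-(m+k))
    have : (n:ℚ)+1 ≠ 0 := by positivity
    push_cast
    field_simp
  rw [Finset.sum_congr rfl h1, ← Finset.mul_sum, qbeta_sum, Nat.cast_choose ℚ (show m ≤ 2*m by omega)]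
  unfold qbeta
  rw [show 2*m-m = m by omega, show m+m+1 = 2*m+1 by ring, Nat.factorial_succ (2*m)]
  have := Nat.factorial_ne_zero (2*m)
  have := Nat.factorial_ne_zero m
  push_cast
  field_simp

lemma Hodd_eq (n : ℕ) :
    ∑ m ∈ Finset.range (n / 2 + 1), (1 : ℚ) / (2 * m + 1 : ℕ) = Hodd (n + 1) := by
  unfold Hodd
  rw [← Finset.sum_filter]
  refine Finset.sum_bij (fun m _ => 2 * m + 1) ?_ ?_ ?_ ?_
  · intro m hm
    have := Finset.mem_range.1 hm
    simp only [Finset.mem_filter, Finset.mem_Icc]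
    exact ⟨by omega, ⟨m, rfl⟩⟩
  · intro a _ b _ h
    omega
  · intro b hb
    simp only [Finset.mem_filter, Finset.mem_Icc] at hb
    obtain ⟨hb, c, rfl⟩ := hb
    exact ⟨c, Finset.mem_range.2 (by omega), rfl⟩
  · intro m _; rfl

/-- For every `n ≥ 0`,
`(1/(n+1)) · Σ_{m=0}^{⌊n/2⌋} Σ_{ℓ=m}^{n−m} C(2m,m)·C(n−2m,ℓ−m)/C(n,ℓ) = H^odd_{n+1}`. -/
theorem quicksort_double_sum_eq_odd_harmonic (n : ℕ) :
    (1 / ((n : ℚ) + 1)) *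
        ∑ m ∈ Finset.range (n / 2 + 1), ∑ l ∈ Finset.Icc m (n - m),
          ((2 * m).choose m : ℚ) * ((n - 2 * m).choose (l - m) : ℚ) / (n.choose l : ℚ)
      = Hodd (n + 1) := by
  rw [← Hodd_eq, Finset.mul_sum]
  refine Finset.sum_congr rfl fun m hm => qs_inner_sum n m ?_
  have := Finset.mem_range.1 hm
  omega
end

section
/- Define, for natural numbers 0 ≤ ℓ ≤ n, F(n,ℓ) = Σ_{0 ≤ k < ℓ} C(n,k)/C(n,ℓ) and G(n,ℓ) = (ℓ−1) + (ℓ−1−n)·F(n,ℓ). Then for all natural numbers n and ℓ with 0 ≤ ℓ < n, the creative-telescoping relation (n+1)·F(n+1,ℓ) − (n+2)·F(n,ℓ) = G(n,ℓ+1) − G(n,ℓ) holds. -/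
/-- `F(n,ℓ) = Σ_{0 ≤ k < ℓ} C(n,k)/C(n,ℓ)`. -/
def F (n l : ℕ) : ℚ := ∑ k ∈ Finset.range l, (n.choose k : ℚ) / (n.choose l : ℚ)

/-- `G(n,ℓ) = (ℓ−1) + (ℓ−1−n)·F(n,ℓ)`. -/
def G (n l : ℕ) : ℚ := ((l : ℚ) - 1) + ((l : ℚ) - 1 - (n : ℚ)) * F n l

theorem sum_choose_succ_aux (n m : ℕ) :
    ∑ k ∈ Finset.range (m + 1), ((n + 1).choose k : ℚ)
      = 2 * ∑ k ∈ Finset.range (m + 1), (n.choose k : ℚ) - (n.choose m : ℚ) := by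
  induction m with
  | zero => simp; norm_num
  | succ m ih =>
    rw [Finset.sum_range_succ, ih, Finset.sum_range_succ _ (m + 1), Nat.choose_succ_succ]
    push_cast
    ring

/-- Creative telescoping relation:
`(n+1)·F(n+1,ℓ) − (n+2)·F(n,ℓ) = G(n,ℓ+1) − G(n,ℓ)` for `0 ≤ ℓ < n`. -/
theorem creative_telescoping (n l : ℕ) (h : l < n) :
    ((n : ℚ) + 1) * F (n + 1) l - ((n : ℚ) + 2) * F n l = G n (l + 1) - G n l := by
  have hc : (n.choose l : ℚ) ≠ 0 := by exact_mod_cast (Nat.choose_pos h.le).ne'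
  have hc1 : (n.choose (l + 1) : ℚ) ≠ 0 := by exact_mod_cast (Nat.choose_pos h).ne'
  have hc2 : ((n + 1).choose l : ℚ) ≠ 0 := by
    exact_mod_cast (Nat.choose_pos (by omega : l ≤ n + 1)).ne'
  have hlt : (l : ℚ) < n := by exact_mod_cast h
  have e1 : (n.choose (l + 1) : ℚ) * (l + 1) = n.choose l * ((n : ℚ) - l) := by
    have := Nat.choose_succ_right_eq n l
    rw [← Nat.cast_sub h.le]
    exact_mod_cast this
  have e2 : ((n + 1).choose l : ℚ) * ((n : ℚ) + 1 - l) = n.choose l * ((n : ℚ) + 1) := by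
    have := Nat.choose_mul_succ_eq n l
    have h2 : ((n : ℚ) + 1 - l) = ((n + 1 - l : ℕ) : ℚ) := by
      rw [Nat.cast_sub (by omega)]; push_cast; ring
    rw [h2]
    exact_mod_cast this.symm
  have e3 : ((n : ℚ) + 1 - l) * ∑ k ∈ Finset.range l, ((n + 1).choose k : ℚ)
      = ((n : ℚ) + 1 - l) * (2 * ∑ k ∈ Finset.range l, (n.choose k : ℚ)) - n.choose l * l := by
    cases l with
    | zero => simp
    | succ m =>
      rw [sum_choose_succ_aux]
      have := Nat.choose_succ_right_eq n m
      have h3 : (n.choose (m + 1) : ℚ) * (m + 1) = n.choose m * ((n : ℚ) - m) := by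
        rw [← Nat.cast_sub (by omega)]
        exact_mod_cast this
      push_cast
      linear_combination h3
  unfold G F
  simp only [← Finset.sum_div]
  rw [Finset.sum_range_succ]
  generalize ∑ k ∈ Finset.range l, ((n + 1).choose k : ℚ) = T at *
  generalize ∑ k ∈ Finset.range l, (n.choose k : ℚ) = S at *
  have hne : (n : ℚ) + 1 - l ≠ 0 := by linarith
  have f1 : ((n : ℚ) + 1) * (T / (n + 1).choose l) = ((n : ℚ) + 1 - l) * T / n.choose l := by
    field_simp
    linear_combination (-T) * e2
  have f2 : ((n : ℚ) - l) * ((S + n.choose l) / n.choose (l + 1))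
      = (l + 1) * (S + n.choose l) / n.choose l := by
    field_simp
    linear_combination (-(S + n.choose l)) * e1
  have f3 : ((n : ℚ) + 1 - l) * T / n.choose l = ((n : ℚ) + 1 - l) * 2 * (S / n.choose l) - l := by
    rw [e3]; field_simp
  have f4 : ((l : ℚ) + 1) * (S + n.choose l) / n.choose l = (l + 1) * (S / n.choose l) + l + 1 := by
    field_simp
    ring
  push_cast
  linear_combination f1 + f3 + f2 + f4
end

section
/- For all natural numbers j and n with 0 ≤ j < n, Σ_{0 ≤ k ≤ j} C(n,k) = Σ_{0 ≤ k ≤ j} 2^k · C(n−k−1, j−k). -/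
/-- For `0 ≤ j < n`, `Σ_{0 ≤ k ≤ j} C(n,k) = Σ_{0 ≤ k ≤ j} 2^k · C(n−k−1, j−k)`. -/
theorem binomial_partial_sum_identity (j n : ℕ) (h : j < n) :
    ∑ k ∈ Finset.range (j + 1), n.choose k
      = ∑ k ∈ Finset.range (j + 1), 2 ^ k * (n - k - 1).choose (j - k) := by
  induction j generalizing n with
  | zero => simp
  | succ j ih =>
    obtain ⟨n, rfl⟩ : ∃ m, n = m + 1 := ⟨n - 1, by omega⟩
    have ih' := ih n (by omega)
    have hL : ∑ k ∈ Finset.range (j + 1 + 1), (n + 1).choose k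
        = 2 * ∑ k ∈ Finset.range (j + 1), n.choose k + n.choose (j + 1) := by
      have h1 := Finset.sum_range_succ' (fun k => n.choose k) (j + 1)
      have h2 := Finset.sum_range_succ (fun k => n.choose k) (j + 1)
      rw [Finset.sum_range_succ']
      simp only [Nat.choose_succ_succ', Finset.sum_add_distrib, Nat.choose_zero_right] at *
      omega
    have hR : ∑ k ∈ Finset.range (j + 1 + 1), 2 ^ k * (n + 1 - k - 1).choose (j + 1 - k)
        = 2 * ∑ k ∈ Finset.range (j + 1), 2 ^ k * (n - k - 1).choose (j - k)
          + n.choose (j + 1) := by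
      rw [Finset.sum_range_succ', Finset.mul_sum]
      congr 1
      · refine Finset.sum_congr rfl fun k _ => ?_
        rw [Nat.add_sub_add_right, Nat.add_sub_add_right, pow_succ]
        ring
      · simp
    rw [hL, hR, ih']
end

section
/- For a natural number n, let S_n = Σ_{0 ≤ k < ℓ < ⌈n/2⌉} C(n,k)/C(n,ℓ) (a rational number). Then for every n ≥ 2, S_n = ((n+1)/(n−1)) · S_{n−2} + (n+1)/(4n) + [n even] · ( 2^{n−2}/(n · C(n, n/2)) − 1/(2(n−1)) − 1/(4n) ). -/
/-- `S_n = Σ_{0 ≤ k < ℓ < ⌈n/2⌉} C(n,k)/C(n,ℓ)`. -/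
def S (n : ℕ) : ℚ :=
  ∑ l ∈ Finset.range ((n + 1) / 2), ∑ k ∈ Finset.range l,
    (n.choose k : ℚ) / (n.choose l : ℚ)

def AA (n l : ℕ) : ℚ := ∑ k ∈ Finset.range l, (n.choose k : ℚ)

theorem AA_succ (n l : ℕ) : AA n (l + 1) = AA n l + n.choose l := by
  simp [AA, Finset.sum_range_succ]

theorem AA_step (n l : ℕ) : AA (n + 1) (l + 1) = 2 * AA n l + n.choose l := by
  induction l with
  | zero => simp [AA]
  | succ l ih =>
    rw [AA_succ, ih, AA_succ, Nat.choose_succ_succ]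
    push_cast
    ring

theorem AA_step2 (n l : ℕ) :
    AA (n + 2) (l + 1) = 4 * AA n l + 2 * n.choose l - (n + 1).choose l := by
  have h1 := AA_step (n + 1) l
  have h2 := AA_succ (n + 1) l
  have h3 := AA_step n l
  rw [show n + 2 = n + 1 + 1 from rfl]
  linarith

theorem S_eq (n : ℕ) : S n = ∑ l ∈ Finset.range ((n + 1) / 2), AA n l / n.choose l := by
  simp only [S, AA, Finset.sum_div]

theorem key (n l : ℕ) (h : l < n) :
    AA (n + 2) (l + 1) / ((n + 2).choose (l + 1) : ℚ) =
      ((n : ℚ) + 3) / (n + 1) * (AA n l / n.choose l)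
      + ((n : ℚ) - (l + 1) + 1) * (n + 1 - 2 * (l + 1)) * (AA n (l + 1) / n.choose (l + 1))
          / ((n + 1) * (n + 2))
      - ((n : ℚ) - l + 1) * (n + 1 - 2 * l) * (AA n l / n.choose l) / ((n + 1) * (n + 2))
      + 2 * (l + 1) / ((n + 1) * (n + 2)) := by
  obtain ⟨d, rfl⟩ : ∃ d, n = l + 1 + d := ⟨n - (l + 1), by omega⟩
  set n := l + 1 + d with hn
  have hc : (0 : ℚ) < n.choose l := by exact_mod_cast Nat.choose_pos (by omega)
  have e1 : ((n + 1).choose l : ℚ) = (n + 1) * n.choose l / (d + 2) := by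
    have := Nat.choose_mul_succ_eq n l
    rw [show n + 1 - l = d + 2 by omega] at this
    rw [eq_div_iff (by positivity)]
    have h' : ((n.choose l * (n + 1) : ℕ) : ℚ) = ((n + 1).choose l * (d + 2) : ℕ) := by rw [this]
    push_cast at h'
    linarith
  have e2 : ((n + 2).choose (l + 1) : ℚ) = (n + 2) * (n + 1).choose l / (l + 1) := by
    have := Nat.add_one_mul_choose_eq (n + 1) l
    rw [eq_div_iff (by positivity)]
    have h' : (((n + 1 + 1) * (n + 1).choose l : ℕ) : ℚ)
      = ((n + 1 + 1).choose (l + 1) * (l + 1) : ℕ) := by rw [this]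
    push_cast at h'
    rw [show n + 2 = n + 1 + 1 from rfl]
    linarith
  have e3 : (n.choose (l + 1) : ℚ) = n.choose l * (d + 1) / (l + 1) := by
    have := Nat.choose_succ_right_eq n l
    rw [show n - l = d + 1 by omega] at this
    rw [eq_div_iff (by positivity)]
    exact_mod_cast this
  rw [AA_step2, AA_succ, e3, e2, e1]
  have hn' : (n : ℚ) = l + 1 + d := by rw [hn]; push_cast; ring
  clear_value n
  generalize (n.choose l : ℚ) = c at *
  generalize AA n l = a at *
  rw [hn']
  have := hc.ne'
  field_simp
  ring

theorem partial_sum (n m : ℕ) (h : m ≤ n) :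
    ∑ l ∈ Finset.range (m + 1), AA (n + 2) l / ((n + 2).choose l : ℚ) =
      ((n : ℚ) + 3) / (n + 1) * ∑ l ∈ Finset.range m, AA n l / (n.choose l : ℚ)
      + ((n : ℚ) - m + 1) * (n + 1 - 2 * m) * (AA n m / n.choose m) / ((n + 1) * (n + 2))
      + m * (m + 1) / ((n + 1) * (n + 2)) := by
  induction m with
  | zero => simp [AA]
  | succ m ih =>
    rw [Finset.sum_range_succ, ih (by omega), key n m (by omega), Finset.sum_range_succ _ m]
    push_cast
    field_simp
    ring

theorem AA_half (m : ℕ) : 2 * AA (2 * m) m = 4 ^ m - (2 * m).choose m := by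
  induction m with
  | zero => simp [AA]
  | succ m ih =>
    have h := AA_step2 (2 * m) m
    have e : ((2 * (m + 1)).choose (m + 1) : ℚ) = 2 * (2 * m + 1).choose m := by
      rw [show 2 * (m + 1) = 2 * m + 1 + 1 by ring, Nat.choose_succ_succ,
        Nat.choose_symm_half]
      push_cast; ring
    rw [e, show 2 * (m + 1) = 2 * m + 2 by ring, h, pow_succ]
    linarith

theorem S_recurrence (n : ℕ) (h : 2 ≤ n) :
    S n = (((n : ℚ) + 1) / ((n : ℚ) - 1)) * S (n - 2) + ((n : ℚ) + 1) / (4 * (n : ℚ))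
      + (if Even n then
          (2 : ℚ) ^ (n - 2) / ((n : ℚ) * (n.choose (n / 2) : ℚ))
            - 1 / (2 * ((n : ℚ) - 1)) - 1 / (4 * (n : ℚ))
        else 0) := by
  obtain ⟨n, rfl⟩ : ∃ k, n = k + 2 := ⟨n - 2, by omega⟩
  have hp := partial_sum n ((n + 1) / 2) (by omega)
  rw [S_eq, S_eq, show (n + 2 + 1) / 2 = (n + 1) / 2 + 1 by omega, hp, Nat.add_sub_cancel]
  generalize ∑ l ∈ Finset.range ((n + 1) / 2), AA n l / (n.choose l : ℚ) = s
  have a1 : ((n + 2 : ℕ) : ℚ) - 1 = n + 1 := by push_cast; ring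
  rw [a1]
  push_cast
  rcases Nat.even_or_odd' n with ⟨m, rfl | rfl⟩
  · rw [if_pos (by simp [parity_simps]), show (2 * m + 1) / 2 = m by omega,
      show (2 * m + 2) / 2 = m + 1 by omega]
    have hA : AA (2 * m) m = (4 ^ m - (2 * m).choose m) / 2 := by
      rw [← AA_half]; ring
    have hc : (0 : ℚ) < (2 * m).choose m := by exact_mod_cast Nat.choose_pos (by omega)
    have e : ((2 * m + 2).choose (m + 1) : ℚ) = 2 * (2 * m + 1) * (2 * m).choose m / (m + 1) := by
      have := Nat.succ_mul_centralBinom_succ m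
      simp only [Nat.centralBinom] at this
      rw [eq_div_iff (by positivity), mul_comm]
      exact_mod_cast this
    rw [hA, e, pow_mul]
    generalize ((2 * m).choose m : ℚ) = c at *
    have := hc.ne'
    push_cast
    norm_num
    field_simp
    ring
  · rw [if_neg (by simp [parity_simps]), show (2 * m + 1 + 1) / 2 = m + 1 by omega]
    push_cast
    field_simp
    ring
end

section
/- For all natural numbers j, m, n with 0 ≤ j ≤ m ≤ n, Σ_{ℓ=j}^{n−m+j} C(m,j) · C(n−m, ℓ−j) / C(n,ℓ) = (n+1)/(m+1). (In the random lattice path model this says that for every m ≤ n and every feasible height k = m − 2j, the probability that a random path of length n passes through the point (n−m, k) equals 1/(m+1).) -/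
theorem aux_sum (d : ℕ) : ∀ j b : ℕ,
    ∑ i ∈ Finset.range (d + 1), (d.choose i : ℚ) * (((j + b + d).choose (j + i) : ℕ) : ℚ)⁻¹
      = ((j : ℚ) + b + d + 1) / (((j : ℚ) + b + 1) * ((j + b).choose j : ℚ)) := by
  induction d with
  | zero =>
    intro j b
    have h : ((j : ℚ) + b + 1) ≠ 0 := by positivity
    simp
    field_simp
  | succ d ih =>
    intro j b
    have key := Finset.sum_choose_succ_mul (R := ℚ)
      (fun i _ => (((j + b + (d + 1)).choose (j + i) : ℕ) : ℚ)⁻¹) d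
    have h1 := ih j (b + 1)
    have h2 := ih (j + 1) b
    rw [show j + (b + 1) + d = j + b + (d + 1) by ring] at h1
    simp only [show j + (b + 1) + d = j + b + (d + 1) by ring,
      show ∀ i, j + 1 + i = j + (i + 1) from fun i => by ring] at h2
    rw [show d + 1 + 1 = d + 2 from rfl, key, h1, h2]
    have hc : (0 : ℚ) < ((j + b).choose j : ℚ) := by
      exact_mod_cast Nat.choose_pos (Nat.le_add_right j b)
    have e1 : ((j + (b + 1)).choose j : ℚ) = ((j : ℚ) + b + 1) * ((j + b).choose j : ℚ) / (b + 1) := by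
      have := Nat.choose_mul_succ_eq (j + b) j
      rw [show j + b + 1 - j = b + 1 by omega] at this
      rw [eq_div_iff (by positivity), show j + (b + 1) = j + b + 1 by ring]
      have t : (((j + b).choose j * (j + b + 1) : ℕ) : ℚ) = _ := congrArg Nat.cast this
      push_cast at t
      linarith
    have e2 : ((j + (b + 1)).choose (j + 1) : ℚ) = ((j : ℚ) + b + 1) * ((j + b).choose j : ℚ) / (j + 1) := by
      have := Nat.add_one_mul_choose_eq (j + b) j
      rw [eq_div_iff (by positivity), show j + (b + 1) = j + b + 1 by ring]
      have t : (((j + b + 1) * (j + b).choose j : ℕ) : ℚ) = _ := congrArg Nat.cast this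
      push_cast at t
      linarith
    rw [e1, e2]
    push_cast
    field_simp
    ring

/-- For `0 ≤ j ≤ m ≤ n`,
`Σ_{ℓ=j}^{n−m+j} C(m,j)·C(n−m,ℓ−j)/C(n,ℓ) = (n+1)/(m+1)`.
(Probabilistically: a random lattice path of length `n` passes through the point
`(n−m, m−2j)` with probability `1/(m+1)`.) -/
theorem prob_point_uniform (j m n : ℕ) (hjm : j ≤ m) (hmn : m ≤ n) :
    ∑ l ∈ Finset.Icc j (n - m + j),
        (m.choose j : ℚ) * ((n - m).choose (l - j) : ℚ) / (n.choose l : ℚ)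
      = ((n : ℚ) + 1) / ((m : ℚ) + 1) := by
  obtain ⟨b, rfl⟩ := Nat.exists_eq_add_of_le hjm
  obtain ⟨d, rfl⟩ := Nat.exists_eq_add_of_le hmn
  have hc : (0 : ℚ) < ((j + b).choose j : ℚ) := by
    exact_mod_cast Nat.choose_pos (Nat.le_add_right j b)
  have h := aux_sum d j b
  rw [Nat.add_sub_cancel_left, ← Finset.Ico_add_one_right_eq_Icc, Finset.sum_Ico_eq_sum_range,
    show d + j + 1 - j = d + 1 by omega]
  simp only [Nat.add_sub_cancel_left, div_eq_mul_inv _ (((_ : ℕ) : ℚ)), mul_assoc]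
  rw [← Finset.mul_sum, h]
  push_cast
  field_simp
end

section
/- Let n ≥ 0 and s be natural numbers with 0 ≤ s ≤ n and s ≡ n (mod 2), and set ℓ = (n−s)/2. Then the sum, over all lattice paths w of length n starting at height s, of the number of indices i with 0 ≤ i ≤ n−1 and w_i = 0 (i.e., of all zeros except possibly the final one at i = n) equals 2 · Σ_{k=0}^{ℓ−1} C(n,k). -/
/-- The height after `i` steps of the walk starting at height `s` whose `j`-th step is
`+1` if `σ j = true` and `−1` if `σ j = false`. -/
def walk {n : ℕ} (s : ℤ) (σ : Fin n → Bool) (i : ℕ) : ℤ :=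
  s + ∑ j : Fin n, if (j : ℕ) < i then (if σ j then 1 else -1) else 0

/-- The lattice paths of length `n` starting at height `s` (and ending at height `0`),
encoded by their step sequences. -/
def paths (n : ℕ) (s : ℤ) : Finset (Fin n → Bool) :=
  Finset.univ.filter (fun σ => walk s σ n = 0)

lemma walk_zero' {n : ℕ} (s : ℤ) (σ : Fin n → Bool) : walk s σ 0 = s := by
  simp [walk]

lemma walk_cons {n : ℕ} (s : ℤ) (b : Bool) (τ : Fin n → Bool) (i : ℕ) :
    walk s (Fin.cons b τ : Fin (n+1) → Bool) (i+1) = walk (s + if b then 1 else -1) τ i := by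
  simp [walk, Fin.sum_univ_succ]
  ring

lemma sum_cons {n : ℕ} (f : (Fin (n+1) → Bool) → ℕ) :
    ∑ σ, f σ = ∑ τ : Fin n → Bool, f (Fin.cons true τ) + ∑ τ : Fin n → Bool, f (Fin.cons false τ) := by
  rw [← (Fin.consEquiv (fun _ : Fin (n+1) => Bool)).sum_comp, Fintype.sum_prod_type]
  simp [Fin.consEquiv]

lemma card_rec (n : ℕ) (s : ℤ) :
    (paths (n+1) s).card = (paths n (s+1)).card + (paths n (s-1)).card := by
  simp only [paths, Finset.card_filter]
  rw [sum_cons]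
  simp [walk_cons, sub_eq_add_neg]

lemma card_big (n : ℕ) : ∀ s : ℤ, (n : ℤ) < s → (paths n s).card = 0 := by
  induction n with
  | zero => intro s hs; simp [paths, walk]; push_cast at hs; omega
  | succ n ih =>
    intro s hs
    push_cast at hs
    rw [card_rec, ih _ (by omega), ih _ (by omega)]

lemma card_eq (n : ℕ) : ∀ k : ℕ, (paths n ((n : ℤ) - 2 * k)).card = n.choose k := by
  induction n with
  | zero =>
    intro k
    rcases k with _ | k
    · simp [paths, walk]
    · simp [paths, walk]; omega
  | succ n ih =>
    intro k
    rw [card_rec]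
    have h1 := ih k
    rw [show ((n + 1 : ℕ) : ℤ) - 2 * k - 1 = n - 2 * k by push_cast; ring, h1]
    rcases k with _ | k
    · rw [card_big _ _ (by push_cast; omega)]; simp
    · rw [show ((n + 1 : ℕ) : ℤ) - 2 * (k + 1 : ℕ) + 1 = n - 2 * k by push_cast; ring, ih k,
        Nat.choose_succ_succ]

def totZ (n : ℕ) (s : ℤ) : ℕ :=
  ∑ σ ∈ paths n s, ((Finset.range n).filter (fun i => walk s σ i = 0)).card

lemma totZ_rec (n : ℕ) (s : ℤ) :
    totZ (n+1) s = (if s = 0 then (paths (n+1) s).card else 0)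
      + (totZ n (s+1) + totZ n (s-1)) := by
  have key : ∀ σ : Fin (n+1) → Bool,
      ((Finset.range (n+1)).filter (fun i => walk s σ i = 0)).card =
      (if s = 0 then 1 else 0) +
        ((Finset.range n).filter (fun i => walk s σ (i+1) = 0)).card := by
    intro σ
    simp only [Finset.card_filter]
    rw [Finset.sum_range_succ', walk_zero', add_comm]
  unfold totZ
  simp only [key, Finset.sum_add_distrib]
  congr 1
  · split_ifs <;> simp
  · simp only [paths, Finset.sum_filter]
    rw [sum_cons]
    simp [walk_cons, sub_eq_add_neg]

lemma sum_pascal (n l : ℕ) : ∑ k ∈ Finset.range l, (n+1).choose k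
    = ∑ k ∈ Finset.range l, n.choose k + ∑ k ∈ Finset.range (l-1), n.choose k := by
  rcases l with _ | l
  · simp
  · rw [Finset.sum_range_succ', Finset.sum_range_succ' (fun k => n.choose k)]
    simp only [Nat.choose_succ_succ, Finset.sum_add_distrib]
    simp
    ring

lemma totZ_eq (n : ℕ) : ∀ s : ℤ, s % 2 = (n : ℤ) % 2 →
    totZ n s = 2 * ∑ k ∈ Finset.range ((n - s.natAbs) / 2), n.choose k := by
  induction n with
  | zero => intro s _; simp [totZ]
  | succ n ih =>
    intro s hs
    push_cast at hs
    rw [totZ_rec, ih _ (by omega), ih _ (by omega), sum_pascal]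
    rcases lt_trichotomy s 0 with h | h | h
    · rw [if_neg (by omega), show (n - (s+1).natAbs)/2 = (n + 1 - s.natAbs)/2 by omega,
        show (n - (s-1).natAbs)/2 = (n + 1 - s.natAbs)/2 - 1 by omega]
      ring
    · subst h
      obtain ⟨m, rfl⟩ : ∃ m, n = 2 * m + 1 := ⟨n / 2, by omega⟩
      have hc := card_eq (2*m+1+1) (m+1)
      rw [show ((2*m+1+1 : ℕ) : ℤ) - 2 * (m+1 : ℕ) = 0 by push_cast; ring] at hc
      rw [if_pos rfl, hc]
      have e1 : (2*m+1 - ((0:ℤ)+1).natAbs)/2 = m := by simp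
      have e2 : (2*m+1 - ((0:ℤ)-1).natAbs)/2 = m := by simp
      have e3 : (2*m+1+1 - (0:ℤ).natAbs)/2 = m+1 := by simp; omega
      rw [e1, e2, e3, Finset.sum_range_succ, Nat.choose_succ_succ, Nat.choose_symm_half]
      simp only [Nat.add_sub_cancel]
      ring
    · rw [if_neg (by omega), show (n - (s-1).natAbs)/2 = (n + 1 - s.natAbs)/2 by omega,
        show (n - (s+1).natAbs)/2 = (n + 1 - s.natAbs)/2 - 1 by omega]
      ring

/-- For `s ≤ n` with `s ≡ n (mod 2)` and `ℓ = (n−s)/2`: the total number, over all lattice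
paths of length `n` starting at height `s`, of indices `0 ≤ i ≤ n−1` with `w_i = 0`
equals `2·Σ_{k=0}^{ℓ−1} C(n,k)`. -/
theorem total_nonfinal_zeros (n s : ℕ) (hs : s ≤ n) (hpar : s % 2 = n % 2) :
    ∑ σ ∈ paths n (s : ℤ),
        ((Finset.range n).filter (fun i => walk (s : ℤ) σ i = 0)).card
      = 2 * ∑ k ∈ Finset.range ((n - s) / 2), n.choose k := by
  have h := totZ_eq n (s : ℤ) (by omega)
  simpa [totZ] using h
end

section
/- For all natural numbers n ≥ 1 and r ≥ 1, Σ_{ℓ=r−1}^{⌈n/2⌉−1} ℓ! · (n − 2ℓ + r − 1) / (ℓ−r+1)! = r! · C(⌈n/2⌉, r) · ( 2⌈n/2⌉/(r(r+1)) + (r−1)/(r+1) + [n even]/r ), where the factor (n − 2ℓ + r − 1) is evaluated in ℤ and the identity holds in ℚ. -/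
lemma aux_sum_s12 (s : ℕ) (x : ℚ) (M : ℕ) :
    ∑ l ∈ Finset.range M, ((l.choose s : ℕ) : ℚ) * (x - 2 * l + s)
      = ((M.choose (s+1) : ℕ) : ℚ) * (x + s + 2 - 2 * (s+1) * (M+1) / (s+2)) := by
  induction M with
  | zero => simp
  | succ M ih =>
    rw [Finset.sum_range_succ, ih, Nat.choose_succ_succ]
    have h : ((M.choose (s+1) : ℕ) : ℚ) * (s+1) = (M.choose s : ℕ) * ((M:ℚ) - s) := by
      rcases le_or_gt s M with hs | hs
      · have := Nat.choose_succ_right_eq M s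
        have h2 : ((M.choose (s+1) * (s+1) : ℕ) : ℚ) = ((M.choose s * (M - s) : ℕ) : ℚ) := by
          rw [this]
        push_cast [Nat.cast_sub hs] at h2
        exact h2
      · rw [Nat.choose_eq_zero_of_lt hs, Nat.choose_eq_zero_of_lt (by omega)]
        simp
    have h3 : (s:ℚ) + 2 ≠ 0 := by positivity
    push_cast
    field_simp
    linear_combination 2 * h

/-- For `n ≥ 1`, `r ≥ 1`:
`Σ_{ℓ=r−1}^{⌈n/2⌉−1} ℓ!·(n−2ℓ+r−1)/(ℓ−r+1)!
  = r!·C(⌈n/2⌉,r)·( 2⌈n/2⌉/(r(r+1)) + (r−1)/(r+1) + [n even]/r )`. -/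
theorem factorial_sum_identity (n r : ℕ) (hn : 1 ≤ n) (hr : 1 ≤ r) :
    ∑ l ∈ Finset.Icc (r - 1) ((n + 1) / 2 - 1),
        (Nat.factorial l : ℚ) * (((n : ℤ) - 2 * l + r - 1 : ℤ) : ℚ)
          / (Nat.factorial (l - r + 1) : ℚ)
      = (Nat.factorial r : ℚ) * ((((n + 1) / 2).choose r : ℚ)) *
          (2 * (((n + 1) / 2 : ℕ) : ℚ) / ((r : ℚ) * ((r : ℚ) + 1))
            + ((r : ℚ) - 1) / ((r : ℚ) + 1)
            + (if Even n then 1 / (r : ℚ) else 0)) := by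
  obtain ⟨s, rfl⟩ : ∃ s, r = s + 1 := ⟨r - 1, by omega⟩
  obtain ⟨m, hm⟩ : ∃ m, m = (n + 1) / 2 := ⟨_, rfl⟩
  rw [← hm]
  have key : ∑ l ∈ Finset.Icc (s + 1 - 1) (m - 1),
        (Nat.factorial l : ℚ) * (((n : ℤ) - 2 * l + (s + 1 : ℕ) - 1 : ℤ) : ℚ)
          / (Nat.factorial (l - (s + 1) + 1) : ℚ)
      = ∑ l ∈ Finset.range m,
        (Nat.factorial s : ℚ) * (((l.choose s : ℕ) : ℚ) * ((n : ℚ) - 2 * l + s)) := by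
    have hsub : Finset.Icc (s + 1 - 1) (m - 1) ⊆ Finset.range m := by
      intro l hl
      simp only [Finset.mem_Icc, Finset.mem_range] at *
      omega
    rw [← Finset.sum_subset hsub]
    · apply Finset.sum_congr rfl
      intro l hl
      simp only [Finset.mem_Icc] at hl
      have hsl : s ≤ l := by omega
      have hf : Nat.factorial (l - (s + 1) + 1) = Nat.factorial (l - s) := by
        rcases Nat.eq_or_lt_of_le hsl with h | h
        · subst h; simp
        · congr 1; omega
      have hc : ((l.choose s : ℕ) : ℚ) * (s.factorial : ℚ) * ((l - s).factorial : ℚ)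
          = (l.factorial : ℚ) := by
        exact_mod_cast Nat.choose_mul_factorial_mul_factorial hsl
      have hne : ((l - s).factorial : ℚ) ≠ 0 := by
        exact_mod_cast Nat.factorial_ne_zero _
      rw [hf, ← hc]
      push_cast
      field_simp
      ring
    · intro l hl hl2
      simp only [Finset.mem_Icc, Finset.mem_range] at *
      rw [Nat.choose_eq_zero_of_lt (by omega)]
      simp
  rw [key, ← Finset.mul_sum, aux_sum_s12, Nat.factorial_succ]
  have h3 : (s:ℚ) + 2 ≠ 0 := by positivity
  have h1 : (s:ℚ) + 1 ≠ 0 := by positivity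
  have h4 : (s:ℚ) + 1 + 1 ≠ 0 := by positivity
  have hs2 : (s:ℚ) + 1 + 1 = s + 2 := by ring
  push_cast
  rw [hs2]
  split_ifs with he
  · have hn2 : n = 2 * m := by
      obtain ⟨k, hk⟩ := he
      omega
    have hq : (n:ℚ) = 2 * m := by exact_mod_cast hn2
    rw [hq]
    field_simp
    ring
  · have hn2 : n + 1 = 2 * m := by
      obtain ⟨k, hk⟩ := Nat.not_even_iff_odd.mp he
      omega
    have hq : (n:ℚ) = 2 * m - 1 := by
      have : (n:ℚ) + 1 = 2 * m := by exact_mod_cast hn2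
      linarith
    rw [hq]
    field_simp
    ring
end
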